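/- arXiv:2009.07781 — 9 statements merged into one kernel-verified Lean document; each statement's English description precedes it below -/
import Mathlib

section
/- Let R be a commutative ring, let k ≥ 1 and ℓ ≥ 1 be integers, and let b₁, …, b_{k+ℓ−1} ∈ R. Then the complete homogeneous symmetric polynomials satisfy the recursion τ_ℓ(b₁, …, b_k) = Σ_{j=1}^{ℓ} (−1)^{j+1} τ_{ℓ−j}(b₁, …, b_k) · e_j(b₁, …, b_{k+ℓ−1}), where the elementary symmetric polynomials on the right are taken in the k+ℓ−1 variables b₁, …, b_{k+ℓ−1}. -/
open Classical

/-- The `j`-th elementary symmetric polynomial in the variables `b 1, …, b n`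
(with `e 0 = 1` and `e j = 0` for `j > n`). -/
noncomputable def esym {R : Type*} [CommRing R] (b : ℕ → R) (n j : ℕ) : R :=
  ∑ s ∈ (Finset.Icc 1 n).powersetCard j, ∏ i ∈ s, b i

/-- The complete homogeneous symmetric polynomial of degree `j` in the variables
`b 1, …, b n`: the sum over all nondecreasing tuples `1 ≤ i₁ ≤ … ≤ i_j ≤ n` of
`b i₁ ⋯ b i_j` (with `τ 0 = 1`). -/
noncomputable def hsym {R : Type*} [CommRing R] (b : ℕ → R) (n j : ℕ) : R :=
  ∑ f ∈ Finset.univ.filter (fun f : Fin j → Fin n => Monotone f),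
    ∏ t : Fin j, b ((f t : ℕ) + 1)

theorem esym_zero {R : Type*} [CommRing R] (b : ℕ → R) (n : ℕ) : esym b n 0 = 1 := by
  simp [esym]

theorem esym_eq_zero_of_lt {R : Type*} [CommRing R] (b : ℕ → R) {n j : ℕ} (h : n < j) :
    esym b n j = 0 := by
  rw [esym, Finset.powersetCard_eq_empty.2 (by simpa using h), Finset.sum_empty]

theorem esym_succ_succ {R : Type*} [CommRing R] (b : ℕ → R) (n j : ℕ) :
    esym b (n + 1) (j + 1) = esym b n (j + 1) + b (n + 1) * esym b n j := by
  have hnot : n + 1 ∉ Finset.Icc 1 n := by simp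
  have hmem : ∀ s ∈ (Finset.Icc 1 n).powersetCard j, n + 1 ∉ s := fun s hs h =>
    hnot ((Finset.mem_powersetCard.1 hs).1 h)
  unfold esym
  rw [← Finset.insert_Icc_right_eq_Icc_add_one (by omega),
    Finset.powersetCard_succ_insert hnot, Finset.sum_union, Finset.sum_image, Finset.mul_sum]
  · congr 1
    exact Finset.sum_congr rfl fun s hs => Finset.prod_insert (hmem s hs)
  · intro s hs t ht hst
    rw [← Finset.erase_insert (hmem s hs), ← Finset.erase_insert (hmem t ht)]
    exact congrArg (fun u => Finset.erase u (n + 1)) hst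
  · rw [Finset.disjoint_left]
    intro s hs hs'
    obtain ⟨t, -, rfl⟩ := Finset.mem_image.1 hs'
    exact hnot ((Finset.mem_powersetCard.1 hs).1 (Finset.mem_insert_self _ _))

theorem hsym_zero {R : Type*} [CommRing R] (b : ℕ → R) (n : ℕ) : hsym b n 0 = 1 := by
  have h : ∀ f : Fin 0 → Fin n, Monotone f := fun f i => i.elim0
  simp [hsym, h]

theorem hsym_zero_succ {R : Type*} [CommRing R] (b : ℕ → R) (j : ℕ) :
    hsym b 0 (j + 1) = 0 := by
  simp [hsym]

theorem monotone_snoc_last {n j : ℕ} {g : Fin j → Fin (n + 1)} (hg : Monotone g) :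
    Monotone (Fin.snoc g (Fin.last n) : Fin (j + 1) → Fin (n + 1)) := by
  intro x y hxy
  induction y using Fin.lastCases with
  | last => simpa using Fin.le_last _
  | cast y =>
    induction x using Fin.lastCases with
    | last => exact absurd hxy (not_le.2 (Fin.castSucc_lt_last y))
    | cast x => simpa using hg (Fin.castSucc_le_castSucc_iff.1 hxy)

theorem hsym_succ_succ {R : Type*} [CommRing R] (b : ℕ → R) (n j : ℕ) :
    hsym b (n + 1) (j + 1) = hsym b n (j + 1) + b (n + 1) * hsym b (n + 1) j := by
  unfold hsym
  rw [← Finset.sum_filter_not_add_sum_filter _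
    (fun f : Fin (j + 1) → Fin (n + 1) => f (Fin.last j) = Fin.last n), Finset.mul_sum]
  congr 1
  · symm
    refine Finset.sum_bij (fun f _ t => (f t).castSucc) ?_ ?_ ?_ ?_
    · intro f hf
      simp only [Finset.mem_filter, Finset.mem_univ, true_and] at hf ⊢
      exact ⟨fun x y hxy => Fin.castSucc_le_castSucc_iff.2 (hf hxy), (Fin.castSucc_lt_last _).ne⟩
    · intro f _ g _ hfg
      funext t
      exact Fin.castSucc_injective n (congrFun hfg t)
    · intro f hf
      simp only [Finset.mem_filter, Finset.mem_univ, true_and] at hf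
      have hne : ∀ t, f t ≠ Fin.last n := fun t =>
        ((hf.1 (Fin.le_last t)).trans_lt (Fin.lt_last_iff_ne_last.2 hf.2)).ne
      refine ⟨fun t => (f t).castPred (hne t), ?_, by simp⟩
      simp only [Finset.mem_filter, Finset.mem_univ, true_and]
      exact fun x y hxy => Fin.castPred_le_castPred_iff.2 (hf.1 hxy)
    · simp
  · symm
    refine Finset.sum_bij (fun g _ => Fin.snoc g (Fin.last n)) ?_ ?_ ?_ ?_
    · intro g hg
      simp only [Finset.mem_filter, Finset.mem_univ, true_and] at hg ⊢
      exact ⟨monotone_snoc_last hg, by simp⟩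
    · intro f _ g _ hfg
      simpa using congrArg (Fin.init (α := fun _ => Fin (n + 1))) hfg
    · intro f hf
      simp only [Finset.mem_filter, Finset.mem_univ, true_and] at hf
      refine ⟨fun t => f t.castSucc, ?_, ?_⟩
      · simp only [Finset.mem_filter, Finset.mem_univ, true_and]
        exact fun x y hxy => hf.1 (Fin.castSucc_le_castSucc_iff.2 hxy)
      · rw [← hf.2]
        exact Fin.snoc_init_self (α := fun _ => Fin (n + 1)) f
    · intro g _
      simp [Fin.prod_univ_castSucc, mul_comm]

open PowerSeries in
theorem mk_neg_one_pow_mul_esym {R : Type*} [CommRing R] (b : ℕ → R) (n : ℕ) :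
    PowerSeries.mk (fun j => (-1) ^ j * esym b n j) =
      ∏ i ∈ Finset.range n, (1 - C (b (i + 1)) * X) := by
  induction n with
  | zero =>
    ext j
    cases j with
    | zero => simp [esym_zero]
    | succ j => simp [esym_eq_zero_of_lt, coeff_one]
  | succ n ih =>
    rw [Finset.prod_range_succ, ← ih]
    ext j
    cases j with
    | zero => simp [esym_zero]
    | succ j =>
      rw [mul_sub, mul_one, mul_left_comm, map_sub, coeff_C_mul, coeff_succ_mul_X]
      simp only [coeff_mk, esym_succ_succ]
      ring

open PowerSeries in
theorem mk_hsym_mul_prod {R : Type*} [CommRing R] (b : ℕ → R) (n : ℕ) :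
    PowerSeries.mk (hsym b n) * ∏ i ∈ Finset.range n, (1 - C (b (i + 1)) * X) = 1 := by
  induction n with
  | zero =>
    ext j
    cases j with
    | zero => simp [hsym_zero]
    | succ j => simp [hsym_zero_succ, coeff_one]
  | succ n ih =>
    suffices h : PowerSeries.mk (hsym b (n + 1)) * (1 - C (b (n + 1)) * X) =
        PowerSeries.mk (hsym b n) by
      rw [Finset.prod_range_succ, mul_comm (Finset.prod _ _), ← mul_assoc, h, ih]
    ext j
    cases j with
    | zero => simp [hsym_zero]
    | succ j =>
      rw [mul_sub, mul_one, mul_left_comm, map_sub, coeff_C_mul, coeff_succ_mul_X]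
      simp only [coeff_mk, hsym_succ_succ]
      ring

theorem mk_hsym_mul_mk_esym_add {R : Type*} [CommRing R] (b : ℕ → R) (k m : ℕ) :
    PowerSeries.mk (hsym b k) * PowerSeries.mk (fun j => (-1) ^ j * esym b (k + m) j) =
      PowerSeries.mk (fun j => (-1) ^ j * esym (fun i => b (k + i)) m j) := by
  rw [mk_neg_one_pow_mul_esym, mk_neg_one_pow_mul_esym, Finset.prod_range_add, ← mul_assoc,
    mk_hsym_mul_prod, one_mul]
  rfl

/-- For `k ≥ 1`, `ℓ ≥ 1` and `b₁, …, b_{k+ℓ-1}` in a commutative ring,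
`τ_ℓ(b₁, …, b_k) = Σ_{j=1}^{ℓ} (−1)^{j+1} τ_{ℓ−j}(b₁, …, b_k) e_j(b₁, …, b_{k+ℓ−1})`. -/
theorem hsym_esym_recursion {R : Type*} [CommRing R] (k ℓ : ℕ) (hk : 1 ≤ k) (hℓ : 1 ≤ ℓ)
    (b : ℕ → R) :
    hsym b k ℓ =
      ∑ j ∈ Finset.Icc 1 ℓ, (-1 : R) ^ (j + 1) * hsym b k (ℓ - j) * esym b (k + ℓ - 1) j := by
  have h := congrArg (PowerSeries.coeff ℓ) (mk_hsym_mul_mk_esym_add b k (ℓ - 1))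
  rw [mul_comm, PowerSeries.coeff_mul, Finset.Nat.sum_antidiagonal_eq_sum_range_succ_mk,
    ← Nat.add_sub_assoc hℓ, Finset.range_eq_Ico, Finset.sum_eq_sum_Ico_succ_bot (by omega)] at h
  simp only [PowerSeries.coeff_mk, esym_zero, esym_eq_zero_of_lt _ (Nat.sub_lt hℓ one_pos),
    pow_zero, one_mul, mul_zero, Nat.sub_zero, zero_add] at h
  rw [eq_neg_of_add_eq_zero_left h, ← Finset.sum_neg_distrib]
  refine Finset.sum_congr (by ext; simp) fun j _ => ?_
  ring
end

section
/- Let R be a commutative ring, m ≥ 1, and b₁, …, b_m ∈ R. Then the Vandermonde matrix V_{jk} = b_k^{j−1} (1 ≤ j, k ≤ m) admits the LU factorization V = L·U, where L is the lower unitriangular matrix with entries L_{ji} = τ_{j−i}(b₁, …, b_i) for i ≤ j (and 0 for i > j), and U is the upper triangular matrix with entries U_{ik} = ∏_{ℓ=1}^{i−1} (b_k − b_ℓ) for i ≤ k (and 0 for i > k). Concretely, for all 1 ≤ j, k ≤ m: Σ_{i=1}^{min(j,k)} τ_{j−i}(b₁, …, b_i) · ∏_{ℓ=1}^{i−1} (b_k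 − b_ℓ) = b_k^{j−1}. -/
open Classical

/-- Newton interpolation of the monomial `x ^ N` at the nodes `b 1, b 2, …`. -/
theorem sum_hsym_mul_prod_sub {R : Type*} [CommRing R] (b : ℕ → R) (x : R) (N : ℕ) :
    ∑ i ∈ Finset.range (N + 1),
      hsym b (i + 1) (N - i) * ∏ l ∈ Finset.range i, (x - b (l + 1)) = x ^ N := by
  induction N with
  | zero => simp [hsym_zero]
  | succ N ih =>
    have hshift : ∑ i ∈ Finset.range (N + 1),
          hsym b i (N + 1 - i) * ∏ l ∈ Finset.range i, (x - b (l + 1)) +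
          ∏ l ∈ Finset.range (N + 1), (x - b (l + 1)) =
        ∑ i ∈ Finset.range (N + 1),
          hsym b (i + 1) (N - i) * ∏ l ∈ Finset.range (i + 1), (x - b (l + 1)) := by
      have h := Finset.sum_range_succ
        (fun i => hsym b i (N + 1 - i) * ∏ l ∈ Finset.range i, (x - b (l + 1))) (N + 1)
      rw [Finset.sum_range_succ'] at h
      simpa [hsym_zero, hsym_zero_succ] using h.symm
    have hrec : ∑ i ∈ Finset.range (N + 1),
          hsym b (i + 1) (N + 1 - i) * ∏ l ∈ Finset.range i, (x - b (l + 1)) =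
        ∑ i ∈ Finset.range (N + 1),
          hsym b i (N + 1 - i) * ∏ l ∈ Finset.range i, (x - b (l + 1)) +
        ∑ i ∈ Finset.range (N + 1),
          b (i + 1) * hsym b (i + 1) (N - i) * ∏ l ∈ Finset.range i, (x - b (l + 1)) := by
      rw [← Finset.sum_add_distrib]
      refine Finset.sum_congr rfl fun i hi => ?_
      have hi' : N + 1 - i = N - i + 1 := by
        have := Finset.mem_range.mp hi
        omega
      rw [hi', hsym_succ_succ, add_mul]
    rw [Finset.sum_range_succ, hrec, Nat.sub_self, hsym_zero, one_mul, add_right_comm, hshift,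
      ← Finset.sum_add_distrib, pow_succ', ← ih, Finset.mul_sum]
    refine Finset.sum_congr rfl fun i _ => ?_
    rw [Finset.prod_range_succ]
    ring

/-- LU factorization of the Vandermonde matrix `V_{jk} = b_k^{j-1}`: for all
`1 ≤ j, k ≤ m`, `Σ_{i=1}^{min(j,k)} τ_{j−i}(b₁, …, b_i) ∏_{ℓ=1}^{i−1} (b_k − b_ℓ) = b_k^{j−1}`,
i.e. `V = L·U` with `L_{ji} = τ_{j−i}(b₁,…,b_i)` lower unitriangular and
`U_{ik} = ∏_{ℓ=1}^{i−1}(b_k − b_ℓ)` upper triangular. -/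
theorem vandermonde_LU {R : Type*} [CommRing R] (m : ℕ) (hm : 1 ≤ m) (b : ℕ → R) :
    ∀ j ∈ Finset.Icc 1 m, ∀ k ∈ Finset.Icc 1 m,
      ∑ i ∈ Finset.Icc 1 (min j k),
          hsym b i (j - i) * ∏ ℓ ∈ Finset.Icc 1 (i - 1), (b k - b ℓ)
        = b k ^ (j - 1) := by
  intro j hj k hk
  rw [Finset.mem_Icc] at hj hk
  have hsub : Finset.Icc 1 (min j k) ⊆ Finset.Icc 1 j :=
    Finset.Icc_subset_Icc_right (min_le_left j k)
  rw [Finset.sum_subset hsub]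
  · obtain ⟨N, rfl⟩ : ∃ N, j = N + 1 := ⟨j - 1, by omega⟩
    have hIcc : ∀ n, Finset.Icc 1 n = (Finset.range n).map (addRightEmbedding 1) := fun n => by
      rw [Finset.range_eq_Ico, Finset.map_add_right_Ico]
      ext
      simp
    simp only [hIcc, Finset.sum_map, Finset.prod_map, addRightEmbedding_apply,
      Nat.add_sub_cancel, Nat.add_sub_add_right]
    exact sum_hsym_mul_prod_sub b (b k) N
  · intro i hi hi'
    rw [Finset.mem_Icc] at hi hi'
    have hki : k ∈ Finset.Icc 1 (i - 1) := by
      rw [Finset.mem_Icc]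
      omega
    rw [Finset.prod_eq_zero hki (sub_self _), mul_zero]
end

section
/- (Discrete Skorokhod reflection identity.) Let ξ : {1, 2, …} → ℝ, let c : {1, 2, …} → ℝ, and let x₀ ∈ ℝ. Set S(0) = 0 and S(i) = Σ_{j=1}^{i} ξ(j), and define w recursively by w(0) = x₀ and w(i) = max(w(i−1), c(i)) + ξ(i) for i ≥ 1. Then for every i ≥ 1, w(i) = x₀ + S(i) + max_{1 ≤ ℓ ≤ i} max(c(ℓ) − x₀ − S(ℓ−1), 0). -/
/-- The maximum over `1 ≤ ℓ ≤ n + 1` splits off its last term. -/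
theorem sup'_Icc_one_succ {α : Type*} [SemilatticeSup α] (f : ℕ → α) {n : ℕ} (hn : 1 ≤ n) :
    (Finset.Icc 1 (n + 1)).sup' (Finset.nonempty_Icc.mpr (Nat.le_add_left 1 n)) f =
      (Finset.Icc 1 n).sup' (Finset.nonempty_Icc.mpr hn) f ⊔ f (n + 1) := by
  have hIcc : Finset.Icc 1 (n + 1) = insert (n + 1) (Finset.Icc 1 n) := by
    ext; simp only [Finset.mem_Icc, Finset.mem_insert]; omega
  simp only [hIcc, Finset.sup'_insert (Finset.nonempty_Icc.mpr hn), sup_comm]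

/-- Discrete Skorokhod reflection identity: if `S i = Σ_{j=1}^i ξ j` (so `S 0 = 0`),
`w 0 = x₀`, and `w i = max (w (i−1)) (c i) + ξ i` for `i ≥ 1`, then for every `i ≥ 1`,
`w i = x₀ + S i + max_{1 ≤ ℓ ≤ i} max (c ℓ − x₀ − S (ℓ−1)) 0`. -/
theorem discrete_skorokhod_reflection (ξ c : ℕ → ℝ) (x₀ : ℝ) (S w : ℕ → ℝ)
    (hS : ∀ i, S i = ∑ j ∈ Finset.Icc 1 i, ξ j)
    (hw0 : w 0 = x₀)
    (hw : ∀ i, 1 ≤ i → w i = max (w (i - 1)) (c i) + ξ i) :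
    ∀ i, ∀ hi : 1 ≤ i,
      w i = x₀ + S i +
        (Finset.Icc 1 i).sup' (Finset.nonempty_Icc.mpr hi)
          (fun ℓ => max (c ℓ - x₀ - S (ℓ - 1)) 0) := by
  have hS_succ (n : ℕ) : S (n + 1) = S n + ξ (n + 1) := by
    rw [hS, hS, Finset.sum_Icc_succ_top (by omega)]
  intro i hi
  induction i, hi using Nat.le_induction with
  | base =>
    have hS0 : S 0 = 0 := by simp [hS]
    have hS1 := hS_succ 0
    have hw1 := hw 1 le_rfl
    simp only [Nat.sub_self, hw0, zero_add, hS0] at hw1 hS1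
    simp only [Finset.Icc_self, Finset.sup'_singleton, Nat.sub_self, hS0]
    grind
  | succ n hn ih =>
    rw [sup'_Icc_one_succ _ hn, hw (n + 1) (by omega), hS_succ, Nat.add_sub_cancel, ih]
    have hnonneg : 0 ≤ (Finset.Icc 1 n).sup' (Finset.nonempty_Icc.mpr hn)
        (fun ℓ => max (c ℓ - x₀ - S (ℓ - 1)) 0) :=
      (le_max_right _ _).trans
        (Finset.le_sup' (fun ℓ => max (c ℓ - x₀ - S (ℓ - 1)) 0) (Finset.mem_Icc.mpr ⟨hn, le_rfl⟩))
    generalize (Finset.Icc 1 n).sup' (Finset.nonempty_Icc.mpr hn)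
      (fun ℓ => max (c ℓ - x₀ - S (ℓ - 1)) 0) = M at hnonneg ⊢
    grind
end

section
/- Let z : [0, ∞) → ℝ be continuous. For all continuous f, g : [0, ∞) → ℝ and every T ≥ 0, sup_{t ∈ [0, T]} |R_z f(t) − R_z g(t)| ≤ 2 · sup_{t ∈ [0, T]} |f(t) − g(t)|, i.e. the Skorokhod reflection map f ↦ R_z f is 2-Lipschitz with respect to the supremum norm on each compact interval [0, T]. -/
/-- The Skorokhod reflection of `f` off `z`:
`R_z f (t) = f t + sup_{s ∈ [0,t]} max (z s − f s) 0`. -/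
noncomputable def skorokhod (z f : ℝ → ℝ) (t : ℝ) : ℝ :=
  f t + sSup ((fun s => max (z s - f s) 0) '' Set.Icc 0 t)

/-- If `u ≤ v + d` on a nonempty set where `v` is bounded above, the suprema satisfy the same
inequality. -/
theorem sSup_image_le_sSup_image_add {α : Type*} {A : Set α} (hA : A.Nonempty) {u v : α → ℝ}
    {d : ℝ} (hv : BddAbove (v '' A)) (h : ∀ a ∈ A, u a ≤ v a + d) :
    sSup (u '' A) ≤ sSup (v '' A) + d := by
  refine csSup_le (hA.image u) ?_
  rintro _ ⟨a, ha, rfl⟩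
  linarith [h a ha, le_csSup hv (Set.mem_image_of_mem v ha)]

theorem bddAbove_image_max_sub {z f : ℝ → ℝ} (hz : ContinuousOn z (Set.Ici 0))
    (hf : ContinuousOn f (Set.Ici 0)) (t : ℝ) :
    BddAbove ((fun s => max (z s - f s) 0) '' Set.Icc 0 t) :=
  isCompact_Icc.bddAbove_image
    (((hz.sub hf).sup continuousOn_const).mono Set.Icc_subset_Ici_self)

theorem skorokhod_sub_le {z f g : ℝ → ℝ} (hz : ContinuousOn z (Set.Ici 0))
    (hg : ContinuousOn g (Set.Ici 0)) {t d : ℝ} (ht : 0 ≤ t)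
    (h : ∀ s ∈ Set.Icc 0 t, |f s - g s| ≤ d) :
    skorokhod z f t - skorokhod z g t ≤ 2 * d := by
  have hsup := sSup_image_le_sSup_image_add (u := fun s => max (z s - f s) 0) (d := d)
    (Set.nonempty_Icc.2 ht) (bddAbove_image_max_sub hz hg t) fun s hs => by
      have hd := abs_le.1 (h s hs)
      refine max_le ?_ ?_
      · linarith [le_max_left (z s - g s) 0]
      · linarith [le_max_right (z s - g s) 0]
  have hd := abs_le.1 (h t ⟨ht, le_rfl⟩)
  unfold skorokhod
  linarith

/-- The Skorokhod reflection map `f ↦ R_z f` is 2-Lipschitz with respect to the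
supremum norm on each compact interval `[0, T]`:
`sup_{t ∈ [0,T]} |R_z f t − R_z g t| ≤ 2 · sup_{t ∈ [0,T]} |f t − g t|`. -/
theorem skorokhod_lipschitz (z f g : ℝ → ℝ)
    (hz : ContinuousOn z (Set.Ici 0))
    (hf : ContinuousOn f (Set.Ici 0)) (hg : ContinuousOn g (Set.Ici 0))
    (T : ℝ) (hT : 0 ≤ T) :
    sSup ((fun t => |skorokhod z f t - skorokhod z g t|) '' Set.Icc 0 T)
      ≤ 2 * sSup ((fun t => |f t - g t|) '' Set.Icc 0 T) := by
  refine csSup_le ((Set.nonempty_Icc.2 hT).image _) ?_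
  rintro _ ⟨t, ht, rfl⟩
  have hbdd : BddAbove ((fun t => |f t - g t|) '' Set.Icc 0 T) :=
    isCompact_Icc.bddAbove_image ((hf.sub hg).abs.mono Set.Icc_subset_Ici_self)
  have h : ∀ s ∈ Set.Icc 0 t, |f s - g s| ≤ sSup ((fun t => |f t - g t|) '' Set.Icc 0 T) :=
    fun s hs => le_csSup hbdd ⟨s, ⟨hs.1, hs.2.trans ht.2⟩, rfl⟩
  refine abs_sub_le_iff.2 ⟨skorokhod_sub_le hz hg ht.1 h, skorokhod_sub_le hz hf ht.1 ?_⟩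
  intro s hs
  rw [abs_sub_comm]
  exact h s hs
end

section
/- (Monotonicity of the Skorokhod reflection map.) Let f₁, f₂, z₁, z₂ : [0, ∞) → ℝ be continuous functions such that z₁(s) ≤ z₂(s) for all s ≥ 0, f₁(0) ≤ f₂(0), and the difference f₂ − f₁ is nondecreasing on [0, ∞). Then R_{z₁} f₁(t) ≤ R_{z₂} f₂(t) for all t ≥ 0. -/
/-- Monotonicity of the Skorokhod reflection map: if `z₁ ≤ z₂` on `[0,∞)`,
`f₁ 0 ≤ f₂ 0`, and `f₂ − f₁` is nondecreasing on `[0,∞)`, then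
`R_{z₁} f₁ ≤ R_{z₂} f₂` on `[0,∞)`. -/
theorem skorokhod_monotone (f₁ f₂ z₁ z₂ : ℝ → ℝ)
    (hf₁ : ContinuousOn f₁ (Set.Ici 0)) (hf₂ : ContinuousOn f₂ (Set.Ici 0))
    (hz₁ : ContinuousOn z₁ (Set.Ici 0)) (hz₂ : ContinuousOn z₂ (Set.Ici 0))
    (hz : ∀ s ∈ Set.Ici (0 : ℝ), z₁ s ≤ z₂ s)
    (h0 : f₁ 0 ≤ f₂ 0)
    (hmono : MonotoneOn (fun s => f₂ s - f₁ s) (Set.Ici 0)) :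
    ∀ t ∈ Set.Ici (0 : ℝ), skorokhod z₁ f₁ t ≤ skorokhod z₂ f₂ t := by
  intro t ht
  have ht0 : (0 : ℝ) ≤ t := ht
  have hsub : Set.Icc (0 : ℝ) t ⊆ Set.Ici 0 := fun s hs => hs.1
  have hbdd : BddAbove ((fun s => max (z₂ s - f₂ s) 0) '' Set.Icc 0 t) :=
    isCompact_Icc.bddAbove_image
      (((hz₂.sub hf₂).sup continuousOn_const).mono hsub)
  have hsup : sSup ((fun s => max (z₁ s - f₁ s) 0) '' Set.Icc 0 t) ≤
      f₂ t - f₁ t + sSup ((fun s => max (z₂ s - f₂ s) 0) '' Set.Icc 0 t) := by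
    apply csSup_le ((Set.nonempty_Icc.2 ht0).image _)
    rintro _ ⟨s, hs, rfl⟩
    have hle : max (z₂ s - f₂ s) 0 ≤
        sSup ((fun s => max (z₂ s - f₂ s) 0) '' Set.Icc 0 t) :=
      le_csSup hbdd ⟨s, hs, rfl⟩
    have hst : f₂ s - f₁ s ≤ f₂ t - f₁ t := hmono (hsub hs) ht hs.2
    have h0t : f₂ 0 - f₁ 0 ≤ f₂ t - f₁ t := hmono Set.self_mem_Ici ht ht0
    have hzs := hz s (hsub hs)
    have hl := le_max_left (z₂ s - f₂ s) 0
    have hr := le_max_right (z₂ s - f₂ s) 0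
    exact max_le (by linarith) (by linarith)
  unfold skorokhod
  linarith
end

section
/- (The reflected kernel identity R^{(r)}_{[−L,L]} = e^{−LH} ϱ_r e^{−LH}.) For all L > 0, r ∈ ℝ, and x, y ∈ ℝ, ∫_ℝ K_L(x, z) · K_L(2r − z, y) dz = (8πL)^{−1/2} exp(−(x + y − 2r − 2L²)²/(8L) − (x + y)L + 2L³/3). -/
/-- The integral kernel of `e^{−tH}` for the Airy Hamiltonian `H = −d²/dx² + x`:
`K_t(x,y) = (4πt)^{−1/2} exp(−(y−x)²/(4t) − t(x+y)/2 + t³/12)`. -/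
noncomputable def airyKernel (t x y : ℝ) : ℝ :=
  Real.exp (-(y - x) ^ 2 / (4 * t) - t * (x + y) / 2 + t ^ 3 / 12) /
    Real.sqrt (4 * Real.pi * t)

/-- Completing the square in the product of two Airy kernels, the first argument of the second
one being reflected at `r`. -/
theorem airyKernel_mul_airyKernel_reflect {L : ℝ} (hL : 0 < L) (r x y z : ℝ) :
    airyKernel L x z * airyKernel L (2 * r - z) y
      = Real.exp (-(x + y - 2 * r - 2 * L ^ 2) ^ 2 / (8 * L) - (x + y) * L + 2 * L ^ 3 / 3) /
          (4 * Real.pi * L) * Real.exp (-(1 / (2 * L)) * (z - (x - y + 2 * r) / 2) ^ 2) := by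
  have hpos : 0 ≤ 4 * Real.pi * L := by positivity
  rw [airyKernel, airyKernel, div_mul_div_comm, Real.mul_self_sqrt hpos, ← Real.exp_add,
    div_mul_eq_mul_div, ← Real.exp_add]
  congr 2
  field_simp
  ring

/-- The reflected kernel identity `R^{(r)}_{[−L,L]} = e^{−LH} ϱ_r e^{−LH}`, where
`ϱ_r f(x) = f(2r − x)`: for all `L > 0`, `r, x, y ∈ ℝ`,
`∫ K_L(x,z) K_L(2r − z, y) dz = (8πL)^{−1/2} exp(−(x+y−2r−2L²)²/(8L) − (x+y)L + 2L³/3)`. -/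
theorem airyKernel_reflection (L r x y : ℝ) (hL : 0 < L) :
    ∫ z : ℝ, airyKernel L x z * airyKernel L (2 * r - z) y
      = Real.exp (-(x + y - 2 * r - 2 * L ^ 2) ^ 2 / (8 * L) - (x + y) * L + 2 * L ^ 3 / 3) /
          Real.sqrt (8 * Real.pi * L) := by
  simp_rw [airyKernel_mul_airyKernel_reflect hL]
  rw [MeasureTheory.integral_const_mul,
    MeasureTheory.integral_sub_right_eq_self
      (fun z : ℝ => Real.exp (-(1 / (2 * L)) * z ^ 2)) ((x - y + 2 * r) / 2),
    integral_gaussian]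
  have hsqrt : √(Real.pi / (1 / (2 * L))) * √(8 * Real.pi * L) = 4 * Real.pi * L := by
    rw [← Real.sqrt_mul (by positivity), Real.sqrt_eq_iff_mul_self_eq (by positivity)
      (by positivity)]
    field_simp
    ring
  have hne : √(8 * Real.pi * L) ≠ 0 := by positivity
  rw [eq_div_iff hne, mul_assoc, hsqrt, div_mul_cancel₀ _ (by positivity)]
end

section
/- Let q : ℝ → ℝ be twice continuously differentiable and satisfy the Painlevé II equation q''(x) = 2q(x)³ + x·q(x) for all x ∈ ℝ. Assume that q² is integrable on [s, ∞) for every s ∈ ℝ, and that q(x)⁴ → 0, q'(x)² → 0 and x·q(x)² → 0 as x → +∞. Then for every x ∈ ℝ, ∫_x^∞ q(y)² dy + q(x)⁴ − q'(x)² + x·q(x)² = 0. -/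
open MeasureTheory Filter

/-- Along a solution of Painlevé II, the quantity `q⁴ − (q')² + x q²` has derivative `q²`. -/
theorem hasDerivAt_painleveII_hamiltonian {q : ℝ → ℝ} {x : ℝ} (hq : DifferentiableAt ℝ q x)
    (hq' : DifferentiableAt ℝ (deriv q) x)
    (hPII : deriv (deriv q) x = 2 * q x ^ 3 + x * q x) :
    HasDerivAt (fun y => q y ^ 4 - (deriv q y) ^ 2 + y * q y ^ 2) (q x ^ 2) x := by
  have hd := hq.hasDerivAt
  have hd' := hq'.hasDerivAt
  rw [hPII] at hd'
  refine (((hd.fun_pow 4).fun_sub (hd'.fun_pow 2)).fun_add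
    ((hasDerivAt_id' x).fun_mul (hd.fun_pow 2))).congr_deriv ?_
  push_cast
  ring

/-- The Painlevé II integral identity `v + q⁴ − (q')² + x q² = 0`: if `q` is a C²
solution of Painlevé II `q'' = 2q³ + xq` with `q²` integrable at `+∞` and
`q⁴, (q')², x q² → 0` as `x → +∞`, then
`∫_x^∞ q(y)² dy + q(x)⁴ − q'(x)² + x q(x)² = 0` for every `x`. -/
theorem painleveII_integral_identity (q : ℝ → ℝ)
    (hq : ContDiff ℝ 2 q)
    (hPII : ∀ x : ℝ, deriv (deriv q) x = 2 * q x ^ 3 + x * q x)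
    (hint : ∀ s : ℝ, IntegrableOn (fun y => q y ^ 2) (Set.Ici s))
    (h1 : Tendsto (fun x => q x ^ 4) atTop (nhds 0))
    (h2 : Tendsto (fun x => (deriv q x) ^ 2) atTop (nhds 0))
    (h3 : Tendsto (fun x => x * q x ^ 2) atTop (nhds 0)) :
    ∀ x : ℝ, (∫ y in Set.Ici x, q y ^ 2) + q x ^ 4 - (deriv q x) ^ 2 + x * q x ^ 2 = 0 := by
  intro x
  have hq' : Differentiable ℝ (deriv q) :=
    ((contDiff_succ_iff_deriv (n := 1)).1 hq).2.2.differentiable one_ne_zero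
  have hlim : Tendsto (fun y => q y ^ 4 - (deriv q y) ^ 2 + y * q y ^ 2) atTop (nhds 0) := by
    simpa using (h1.sub h2).add h3
  have hFTC := integral_Ioi_of_hasDerivAt_of_tendsto' (a := x)
    (fun y _ => hasDerivAt_painleveII_hamiltonian (hq.differentiable two_ne_zero y) (hq' y)
      (hPII y))
    ((hint x).mono_set Set.Ioi_subset_Ici_self) hlim
  rw [integral_Ici_eq_integral_Ioi, hFTC]
  ring
end

section
/- (Compatibility of the Lax pair implies Painlevé II.) Let q : ℝ → ℝ be twice continuously differentiable and let f, g : ℝ² → ℝ be twice continuously differentiable functions of (x, w) satisfying, for all (x, w) ∈ ℝ²: ∂_w f = q(x)² f − (w·q(x) + q'(x)) g, ∂_w g = (−w·q(x) + q'(x)) f + (w² − x − q(x)²) g, ∂_x f = q(x) g, and ∂_x g = q(x) f − w g. If for every x ∈ ℝ there exists w ∈ ℝ with (f(x, w), g(x, w)) ≠ (0, 0), then q satisfies the Painlevé II equation q''(x) = 2q(x)³ + x·q(x) for all x ∈ ℝ. -/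
section MixedPartials

variable {F : ℝ → ℝ → ℝ}

/-- The partial derivative of a function of two variables in its first variable. -/
theorem hasDerivAt_fst_of_hasFDerivAt_uncurry {x w : ℝ} {F' : ℝ × ℝ →L[ℝ] ℝ}
    (h : HasFDerivAt (Function.uncurry F) F' (x, w)) :
    HasDerivAt (fun x' => F x' w) (F' (1, 0)) x :=
  HasFDerivAt.comp_hasDerivAt (f := fun x' => (x', w)) x h
    ((hasDerivAt_id' x).prodMk (hasDerivAt_const x w))

/-- The partial derivative of a function of two variables in its second variable. -/
theorem hasDerivAt_snd_of_hasFDerivAt_uncurry {x w : ℝ} {F' : ℝ × ℝ →L[ℝ] ℝ}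
    (h : HasFDerivAt (Function.uncurry F) F' (x, w)) :
    HasDerivAt (F x) (F' (0, 1)) w :=
  HasFDerivAt.comp_hasDerivAt (f := fun w' => (x, w')) w h
    ((hasDerivAt_const w x).prodMk (hasDerivAt_id' w))

theorem ContDiff.hasFDerivAt_uncurry (hF : ContDiff ℝ 2 (Function.uncurry F)) (p : ℝ × ℝ) :
    HasFDerivAt (Function.uncurry F) (fderiv ℝ (Function.uncurry F) p) p :=
  (hF.differentiable (by norm_num) p).hasFDerivAt

/-- Equality of the mixed partial derivatives of a `C²` function on the plane. -/
theorem ContDiff.deriv_deriv_comm (hF : ContDiff ℝ 2 (Function.uncurry F)) (x w : ℝ) :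
    deriv (fun x' => deriv (F x') w) x = deriv (fun w' => deriv (fun x' => F x' w') x) w := by
  have hfst (x w : ℝ) :=
    (hasDerivAt_fst_of_hasFDerivAt_uncurry (hF.hasFDerivAt_uncurry (x, w))).deriv
  have hsnd (x w : ℝ) :=
    (hasDerivAt_snd_of_hasFDerivAt_uncurry (hF.hasFDerivAt_uncurry (x, w))).deriv
  have hD : HasFDerivAt (fderiv ℝ (Function.uncurry F))
      (fderiv ℝ (fderiv ℝ (Function.uncurry F)) (x, w)) (x, w) :=
    ((hF.fderiv_right (m := 1) (by norm_num)).differentiable (by norm_num) _).hasFDerivAt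
  have hx : HasDerivAt (fun x' => fderiv ℝ (Function.uncurry F) (x', w) (0, 1))
      (fderiv ℝ (fderiv ℝ (Function.uncurry F)) (x, w) (1, 0) (0, 1)) x := by
    simpa using (HasFDerivAt.comp_hasDerivAt (f := fun x' => (x', w)) x hD
      ((hasDerivAt_id' x).prodMk (hasDerivAt_const x w))).clm_apply
        (hasDerivAt_const x ((0, 1) : ℝ × ℝ))
  have hw : HasDerivAt (fun w' => fderiv ℝ (Function.uncurry F) (x, w') (1, 0))
      (fderiv ℝ (fderiv ℝ (Function.uncurry F)) (x, w) (0, 1) (1, 0)) w := by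
    simpa using (HasFDerivAt.comp_hasDerivAt (f := fun w' => (x, w')) w hD
      ((hasDerivAt_const w x).prodMk (hasDerivAt_id' w))).clm_apply
        (hasDerivAt_const w ((1, 0) : ℝ × ℝ))
  simp only [hfst, hsnd]
  rw [hx.deriv, hw.deriv]
  exact hF.contDiffAt.isSymmSndFDerivAt (by simp) (1, 0) (0, 1)

end MixedPartials

/-- Compatibility of the Lax pair implies Painlevé II: if `q` is C², `f, g` are C²
functions of `(x, w)` satisfying the Lax pair
`∂_w f = q² f − (w q + q') g`, `∂_w g = (−w q + q') f + (w² − x − q²) g`,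
`∂_x f = q g`, `∂_x g = q f − w g`,
and for every `x` there is some `w` with `(f(x,w), g(x,w)) ≠ (0,0)`, then `q` satisfies
the Painlevé II equation `q'' = 2q³ + xq`. -/
theorem lax_pair_implies_painleveII (q : ℝ → ℝ) (f g : ℝ → ℝ → ℝ)
    (hq : ContDiff ℝ 2 q)
    (hf : ContDiff ℝ 2 (Function.uncurry f))
    (hg : ContDiff ℝ 2 (Function.uncurry g))
    (h1 : ∀ x w : ℝ, deriv (f x) w = q x ^ 2 * f x w - (w * q x + deriv q x) * g x w)
    (h2 : ∀ x w : ℝ, deriv (g x) w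
      = (-(w * q x) + deriv q x) * f x w + (w ^ 2 - x - q x ^ 2) * g x w)
    (h3 : ∀ x w : ℝ, deriv (fun x' => f x' w) x = q x * g x w)
    (h4 : ∀ x w : ℝ, deriv (fun x' => g x' w) x = q x * f x w - w * g x w)
    (hnz : ∀ x : ℝ, ∃ w : ℝ, ¬(f x w = 0 ∧ g x w = 0)) :
    ∀ x : ℝ, deriv (deriv q) x = 2 * q x ^ 3 + x * q x := by
  intro x
  obtain ⟨w, hw⟩ := hnz x
  have hqx : HasDerivAt q (deriv q x) x := (hq.differentiable (by norm_num) x).hasDerivAt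
  have hq'x : HasDerivAt (deriv q) (deriv (deriv q) x) x :=
    ((ContDiff.deriv' (n := 1) hq).differentiable (by norm_num) x).hasDerivAt
  have hfx : HasDerivAt (fun x' => f x' w) (q x * g x w) x := by
    rw [← h3]
    exact (hasDerivAt_fst_of_hasFDerivAt_uncurry
      (hf.hasFDerivAt_uncurry (x, w))).differentiableAt.hasDerivAt
  have hgx : HasDerivAt (fun x' => g x' w) (q x * f x w - w * g x w) x := by
    rw [← h4]
    exact (hasDerivAt_fst_of_hasFDerivAt_uncurry
      (hg.hasFDerivAt_uncurry (x, w))).differentiableAt.hasDerivAt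
  have hfw : HasDerivAt (f x) (q x ^ 2 * f x w - (w * q x + deriv q x) * g x w) w := by
    rw [← h1]
    exact (hasDerivAt_snd_of_hasFDerivAt_uncurry
      (hf.hasFDerivAt_uncurry (x, w))).differentiableAt.hasDerivAt
  have hgw : HasDerivAt (g x)
      ((-(w * q x) + deriv q x) * f x w + (w ^ 2 - x - q x ^ 2) * g x w) w := by
    rw [← h2]
    exact (hasDerivAt_snd_of_hasFDerivAt_uncurry
      (hg.hasFDerivAt_uncurry (x, w))).differentiableAt.hasDerivAt
  have hfxw := hf.deriv_deriv_comm x w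
  have hgxw := hg.deriv_deriv_comm x w
  simp only [h1, h2, h3, h4] at hfxw hgxw
  have hf_left := (((hqx.fun_pow 2).fun_mul hfx).fun_sub
    (((hqx.const_mul w).fun_add hq'x).fun_mul hgx)).deriv
  have hf_right := (hgw.const_mul (q x)).deriv
  have hg_left := (((hqx.const_mul w).fun_neg.fun_add hq'x).fun_mul hfx).fun_add
    ((((hasDerivAt_id' x).const_sub (w ^ 2)).fun_sub (hqx.fun_pow 2)).fun_mul hgx) |>.deriv
  have hg_right := ((hfw.const_mul (q x)).fun_sub ((hasDerivAt_id' w).fun_mul hgw)).deriv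
  rw [hf_left, hf_right] at hfxw
  rw [hg_left, hg_right] at hgxw
  have hg_zero : (deriv (deriv q) x - (2 * q x ^ 3 + x * q x)) * g x w = 0 := by
    push_cast at hfxw
    linear_combination -hfxw
  have hf_zero : (deriv (deriv q) x - (2 * q x ^ 3 + x * q x)) * f x w = 0 := by
    push_cast at hgxw
    linear_combination hgxw
  by_contra hne
  exact hw ⟨(mul_eq_zero.mp hf_zero).resolve_left (sub_ne_zero.mpr hne),
    (mul_eq_zero.mp hg_zero).resolve_left (sub_ne_zero.mpr hne)⟩
end

section
/- (Bloemendal–Virag PDE with m = 1 and β = 4 for the Painlevé II expression.) Let q : ℝ → ℝ be continuously differentiable, assume q is integrable on [s, ∞) for every s, assume v(x) := ∫_x^∞ q(y)² dy is finite and integrable on [s, ∞) for every s, and assume the identity v(x) = q'(x)² − q(x)⁴ − x·q(x)² holds for all x ∈ ℝ. Define E(x) = exp(−½ ∫_x^∞ q(y) dy), F(x) = exp(−½ ∫_x^∞ v(y) dy), and F₁(x) = F(x)E(x). Let f, g : ℝ² → ℝ have continuous first partial derivatives in x and continuous first and second partial derivatives in w, and satisfy for all (x, w) ∈ ℝ²: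 ∂_w f = q(x)² f − (w·q(x) + q'(x)) g, ∂_w g = (−w·q(x) + q'(x)) f + (w² − x − q(x)²) g, ∂_x f = q(x) g, and ∂_x g = q(x) f − w g. Define G(r, b) = F₁(2^{2/3} r) · (f(2^{2/3} r, 2^{1/3} b) − g(2^{2/3} r, 2^{1/3} b)). Then G satisfies the linear PDE ∂_r G + (1/2) ∂²_b G + (r − b²) ∂_b G = 0 at every (r, b) ∈ ℝ². -/
open MeasureTheory

theorem hasDerivAt_setIntegral_Ici {h : ℝ → ℝ} (hc : Continuous h)
    (hi : ∀ s : ℝ, IntegrableOn h (Set.Ici s)) (x : ℝ) :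
    HasDerivAt (fun x => ∫ y in Set.Ici x, h y) (-h x) x := by
  have hsub : (fun x => ∫ y in Set.Ici x, h y) =
      fun x => (∫ y in Set.Ioi (0 : ℝ), h y) - ∫ y in (0 : ℝ)..x, h y := by
    funext t
    rw [integral_Ici_eq_integral_Ioi, eq_sub_iff_add_eq']
    exact intervalIntegral.integral_interval_add_Ioi ((hi 0).mono_set Set.Ioi_subset_Ici_self)
      ((hi t).mono_set Set.Ioi_subset_Ici_self)
  rw [hsub]
  exact (hc.integral_hasStrictDerivAt 0 x).hasDerivAt.const_sub _

theorem hasDerivAt_exp_setIntegral_Ici {h : ℝ → ℝ} (hc : Continuous h)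
    (hi : ∀ s : ℝ, IntegrableOn h (Set.Ici s)) (x : ℝ) :
    HasDerivAt (fun x => Real.exp (-(1 / 2) * ∫ y in Set.Ici x, h y))
      (1 / 2 * h x * Real.exp (-(1 / 2) * ∫ y in Set.Ici x, h y)) x := by
  convert ((hasDerivAt_setIntegral_Ici hc hi x).const_mul (-(1 / 2))).exp using 1
  ring

/-- The Bloemendal–Virag PDE with `m = 1` and `β = 4` for the Painlevé II expression:
with `q` a continuously differentiable, suitably integrable function satisfying the
identity `v = (q')² − q⁴ − x q²` for `v(x) = ∫_x^∞ q²`, with the Tracy–Widom auxiliary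
functions `E(x) = exp(−½∫_x^∞ q)`, `F(x) = exp(−½∫_x^∞ v)`, `F₁ = F·E`, and with
`(f, g)` a solution of the Painlevé II Lax pair, the function
`G(r, b) = F₁(2^{2/3} r) (f(2^{2/3} r, 2^{1/3} b) − g(2^{2/3} r, 2^{1/3} b))`
satisfies `∂_r G + ½ ∂²_b G + (r − b²) ∂_b G = 0` at every `(r, b) ∈ ℝ²`. -/
theorem bloemendal_virag_pde_m1_beta4
    (q v E F F₁ : ℝ → ℝ) (f g G : ℝ → ℝ → ℝ)
    -- q is continuously differentiable and integrable at +∞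
    (hq : ContDiff ℝ 1 q)
    (hqint : ∀ s : ℝ, IntegrableOn q (Set.Ici s))
    -- v(x) = ∫_x^∞ q(y)² dy is finite and integrable at +∞
    (hq2int : ∀ s : ℝ, IntegrableOn (fun y => q y ^ 2) (Set.Ici s))
    (hv : ∀ x : ℝ, v x = ∫ y in Set.Ici x, q y ^ 2)
    (hvint : ∀ s : ℝ, IntegrableOn v (Set.Ici s))
    -- the integral identity v = (q')² − q⁴ − x q²
    (hid : ∀ x : ℝ, v x = (deriv q x) ^ 2 - q x ^ 4 - x * q x ^ 2)
    -- the Tracy–Widom auxiliary functions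
    (hE : ∀ x : ℝ, E x = Real.exp (-(1 / 2) * ∫ y in Set.Ici x, q y))
    (hF : ∀ x : ℝ, F x = Real.exp (-(1 / 2) * ∫ y in Set.Ici x, v y))
    (hF₁ : ∀ x : ℝ, F₁ x = F x * E x)
    -- f has continuous first partial derivatives in x
    (hfx : ∀ w : ℝ, Differentiable ℝ (fun x => f x w))
    (hfxc : Continuous fun p : ℝ × ℝ => deriv (fun x => f x p.2) p.1)
    -- f has continuous first and second partial derivatives in w
    (hfw : ∀ x : ℝ, ContDiff ℝ 2 (f x))
    (hfwc : Continuous fun p : ℝ × ℝ => deriv (f p.1) p.2)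
    (hfwwc : Continuous fun p : ℝ × ℝ => deriv (deriv (f p.1)) p.2)
    -- g has continuous first partial derivatives in x
    (hgx : ∀ w : ℝ, Differentiable ℝ (fun x => g x w))
    (hgxc : Continuous fun p : ℝ × ℝ => deriv (fun x => g x p.2) p.1)
    -- g has continuous first and second partial derivatives in w
    (hgw : ∀ x : ℝ, ContDiff ℝ 2 (g x))
    (hgwc : Continuous fun p : ℝ × ℝ => deriv (g p.1) p.2)
    (hgwwc : Continuous fun p : ℝ × ℝ => deriv (deriv (g p.1)) p.2)
    -- the Painlevé II Lax pair
    (h1 : ∀ x w : ℝ, deriv (f x) w = q x ^ 2 * f x w - (w * q x + deriv q x) * g x w)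
    (h2 : ∀ x w : ℝ, deriv (g x) w
      = (-(w * q x) + deriv q x) * f x w + (w ^ 2 - x - q x ^ 2) * g x w)
    (h3 : ∀ x w : ℝ, deriv (fun x' => f x' w) x = q x * g x w)
    (h4 : ∀ x w : ℝ, deriv (fun x' => g x' w) x = q x * f x w - w * g x w)
    -- the function G
    (hG : ∀ r b : ℝ, G r b
      = F₁ ((2 : ℝ) ^ ((2 : ℝ) / 3) * r) *
          (f ((2 : ℝ) ^ ((2 : ℝ) / 3) * r) ((2 : ℝ) ^ ((1 : ℝ) / 3) * b) -
           g ((2 : ℝ) ^ ((2 : ℝ) / 3) * r) ((2 : ℝ) ^ ((1 : ℝ) / 3) * b))) :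
    ∀ r b : ℝ,
      deriv (fun r' => G r' b) r + (1 / 2) * deriv (deriv (G r)) b
        + (r - b ^ 2) * deriv (G r) b = 0 := by
  have hvc : Continuous v := by
    rw [funext hid]
    have := hq.continuous
    have := hq.continuous_deriv le_rfl
    fun_prop
  have hF₁d (x : ℝ) : HasDerivAt F₁ (1 / 2 * (v x + q x) * F₁ x) x := by
    have hFd := hasDerivAt_exp_setIntegral_Ici hvc hvint x
    have hEd := hasDerivAt_exp_setIntegral_Ici hq.continuous hqint x
    rw [← funext hF, ← hF] at hFd
    rw [← funext hE, ← hE] at hEd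
    rw [funext hF₁]
    exact (hFd.mul hEd).congr_deriv (by ring)
  have hfw' (x w : ℝ) : HasDerivAt (f x)
      (q x ^ 2 * f x w - (w * q x + deriv q x) * g x w) w :=
    h1 x w ▸ ((hfw x).differentiable two_ne_zero w).hasDerivAt
  have hgw' (x w : ℝ) : HasDerivAt (g x)
      ((-(w * q x) + deriv q x) * f x w + (w ^ 2 - x - q x ^ 2) * g x w) w :=
    h2 x w ▸ ((hgw x).differentiable two_ne_zero w).hasDerivAt
  have hfx' (x w : ℝ) : HasDerivAt (fun x' => f x' w) (q x * g x w) x :=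
    h3 x w ▸ (hfx w x).hasDerivAt
  have hgx' (x w : ℝ) : HasDerivAt (fun x' => g x' w) (q x * f x w - w * g x w) x :=
    h4 x w ▸ (hgx w x).hasDerivAt
  intro r b
  have hc : ((2 : ℝ) ^ ((2 : ℝ) / 3)) = ((2 : ℝ) ^ ((1 : ℝ) / 3)) ^ 2 := by
    rw [← Real.rpow_natCast, ← Real.rpow_mul zero_le_two]
    norm_num
  have hc3 : ((2 : ℝ) ^ ((1 : ℝ) / 3)) ^ 3 = 2 := by
    rw [← Real.rpow_natCast, ← Real.rpow_mul zero_le_two]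
    norm_num
  rw [hc] at hG
  generalize (2 : ℝ) ^ ((1 : ℝ) / 3) = c at hG hc3
  have hGr := (HasDerivAt.comp (h₂ := fun x => F₁ x * (f x (c * b) - g x (c * b))) r
    ((hF₁d _).mul ((hfx' _ _).sub (hgx' _ _)))
    ((hasDerivAt_id r).const_mul (c ^ 2))).congr_of_eventuallyEq
    (f₁ := fun r' => G r' b) (.of_forall fun r' => hG r' b)
  have hwb (t : ℝ) : HasDerivAt (fun b => c * b) (c * 1) t := (hasDerivAt_id t).const_mul c
  have hfb (t : ℝ) := (hfw' (c ^ 2 * r) (c * t)).comp t (hwb t)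
  have hgb (t : ℝ) := (hgw' (c ^ 2 * r) (c * t)).comp t (hwb t)
  have hGb (t : ℝ) := (((hfb t).sub (hgb t)).const_mul (F₁ (c ^ 2 * r))).congr_of_eventuallyEq
    (f₁ := G r) (.of_forall (hG r))
  have hf₂ := ((hfb b).const_mul (q (c ^ 2 * r) ^ 2)).sub
    ((((hwb b).mul_const (q (c ^ 2 * r))).add_const (deriv q (c ^ 2 * r))).mul (hgb b))
  have hg₂ := ((((hwb b).mul_const (q (c ^ 2 * r))).neg.add_const
    (deriv q (c ^ 2 * r))).mul (hfb b)).add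
    (((((hwb b).pow 2).sub_const (c ^ 2 * r)).sub_const (q (c ^ 2 * r) ^ 2)).mul (hgb b))
  have hGbb := (((hf₂.mul_const (c * 1)).sub
    (hg₂.mul_const (c * 1))).const_mul (F₁ (c ^ 2 * r))).congr_of_eventuallyEq
    (f₁ := deriv (G r)) (.of_forall fun t => (hGb t).deriv)
  rw [hGr.deriv, hGbb.deriv, (hGb b).deriv]
  simp only [id, Function.comp_apply, Pi.neg_apply, Pi.pow_apply, Nat.cast_ofNat, hid]
  generalize q (c ^ 2 * r) = q₀, deriv q (c ^ 2 * r) = p, F₁ (c ^ 2 * r) = A,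
    f (c ^ 2 * r) (c * b) = u, g (c ^ 2 * r) (c * b) = y
  linear_combination (-(1 / 2) * (r - b ^ 2) * (A * ((q₀ ^ 2 * u - (c * b * q₀ + p) * y) * c
    - ((-(c * b * q₀) + p) * u + ((c * b) ^ 2 - c ^ 2 * r - q₀ ^ 2) * y) * c))) * hc3
end
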